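/- Let n ≥ 1, let f_1, …, f_n : ℝ^d → ℝ be differentiable convex functions whose gradients are L-Lipschitz (L > 0), let f = (1/n)∑_{i=1}^n f_i, assume f is μ-strongly convex for some μ ≥ 0 (f(x) − f(y) − ⟨∇f(y), x − y⟩ ≥ (μ/2)‖x − y‖² for all x, y), and let x* be a global minimizer of f. Let x, w ∈ ℝ^d, let θ ∈ (0, 1), p ∈ (0, 1], α > 0, and let η > 0 satisfy η ≤ α/( L·(1 + μη)·θ·(1 + 1/(1 − θ)) ). Define u = θx + (1 − θ)w, and for each i ∈ {1,…,n} define g_i = ∇f_i(u) − ∇f_i(w) + ∇f(w), x⁺_i = (1/(1 + μη))·(x + μη·u) − (η/α)·g_i, and b_i = θ·x⁺_i + (1 − θ)·w. Then (1/n)∑_{i=1}^n [ p·f(b_i) + (1 − p)·f(w) ] − f(x*) ≤ (1 − pθ)·( f(w) − f(x*) ) + (pαθ/((1 + μη)·η))·( (1/2)‖x − x⋆‖² − ((1 + μη)/2)·(1/n)∑_{i=1}^n ‖x⁺_i − x*‖² ) − (μ·(1 + μη − α)·pθ/(2(1 + μη)))·‖u − x*‖², where x⋆ denotes x*. -/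

import Mathlib

open scoped RealInnerProductSpace

section GradientInequalities

variable {E : Type*} [NormedAddCommGroup E] [InnerProductSpace ℝ E]

/-- Polarization in the form of the three-point identity. -/
lemma inner_sub_sub_eq_three_point (a y z : E) :
    ⟪a - y, y - z⟫ = (‖a - z‖ ^ 2 - ‖a - y‖ ^ 2 - ‖y - z‖ ^ 2) / 2 := by
  have h := norm_add_sq_real (a - y) (y - z)
  rw [sub_add_sub_cancel] at h
  linarith

/-- Young's inequality for the inner product. -/
lemma inner_le_weighted_norm_sq {c : ℝ} (hc : 0 < c) (a b : E) :
    ⟪a, b⟫ ≤ ‖a‖ ^ 2 / (2 * c) + c / 2 * ‖b‖ ^ 2 := by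
  have h1 := real_inner_le_norm a b
  have h2 : 0 ≤ (‖a‖ - c * ‖b‖) ^ 2 / (2 * c) := by positivity
  have h3 : (‖a‖ - c * ‖b‖) ^ 2 / (2 * c) =
      ‖a‖ ^ 2 / (2 * c) + c / 2 * ‖b‖ ^ 2 - ‖a‖ * ‖b‖ := by
    field_simp
    ring
  linarith

variable [CompleteSpace E]

lemma HasGradientAt.hasDerivAt_comp_add_smul {h : E → ℝ} {h' x v : E} {t : ℝ}
    (hh : HasGradientAt h h' (x + t • v)) :
    HasDerivAt (fun r : ℝ => h (x + r • v)) ⟪h', v⟫ t := by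
  have hline : HasDerivAt (fun r : ℝ => x + r • v) v t := by
    simpa using ((hasDerivAt_id t).smul_const v).const_add x
  have hcomp := hh.hasFDerivAt.comp_hasDerivAt t hline
  rwa [InnerProductSpace.toDual_apply_apply] at hcomp

lemma ConvexOn.add_inner_gradient_le {h : E → ℝ} {h' x : E} (hc : ConvexOn ℝ Set.univ h)
    (hh : HasGradientAt h h' x) (y : E) : h x + ⟪h', y - x⟫ ≤ h y := by
  have hder : HasDerivAt (fun r : ℝ => h (x + r • (y - x))) ⟪h', y - x⟫ 0 :=
    HasGradientAt.hasDerivAt_comp_add_smul (by simpa using hh)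
  have hconv : ConvexOn ℝ Set.univ (fun r : ℝ => h (x + r • (y - x))) := by
    have := hc.comp_affineMap (AffineMap.lineMap x y : ℝ →ᵃ[ℝ] E)
    refine this.congr fun r _ => ?_
    simp [AffineMap.lineMap_apply, add_comm]
  have := hconv.le_slope_of_hasDerivAt (Set.mem_univ 0) (Set.mem_univ 1) one_pos hder
  simp [slope_def_field] at this
  linarith

/-- The descent lemma: a function with `L`-Lipschitz gradient is bounded above by a quadratic. -/
lemma le_add_inner_gradient_add_sq {h : E → ℝ} {h' : E → E} {L : ℝ}
    (hh : ∀ x, HasGradientAt h (h' x) x) (hlip : ∀ x y, ‖h' x - h' y‖ ≤ L * ‖x - y‖) (x y : E) :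
    h y ≤ h x + ⟪h' x, y - x⟫ + L / 2 * ‖y - x‖ ^ 2 := by
  set v := y - x with hv
  have hder (t : ℝ) : HasDerivAt
      (fun r : ℝ => h (x + r • v) - r * ⟪h' x, v⟫ - r ^ 2 * (L / 2 * ‖v‖ ^ 2))
      (⟪h' (x + t • v), v⟫ - ⟪h' x, v⟫ - 2 * t * (L / 2 * ‖v‖ ^ 2)) t := by
    have h1 := (hh (x + t • v)).hasDerivAt_comp_add_smul
    have h2 := (hasDerivAt_id t).mul_const ⟪h' x, v⟫
    have h3 := ((hasDerivAt_id t).pow 2).mul_const (L / 2 * ‖v‖ ^ 2)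
    have h4 := (h1.sub h2).sub h3
    simp only [id, one_mul, Nat.cast_ofNat, Nat.add_one_sub_one, pow_one, mul_one] at h4
    exact h4
  have hanti := antitoneOn_of_hasDerivWithinAt_nonpos (convex_Icc (0 : ℝ) 1)
    (fun t _ => (hder t).continuousAt.continuousWithinAt)
    (fun t _ => (hder t).hasDerivWithinAt) (fun t ht => by
      rw [interior_Icc] at ht
      have h1 := real_inner_le_norm (h' (x + t • v) - h' x) v
      have h2 := hlip (x + t • v) x
      rw [add_sub_cancel_left, norm_smul, Real.norm_of_nonneg ht.1.le] at h2
      have h3 := mul_le_mul_of_nonneg_right h2 (norm_nonneg v)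
      rw [inner_sub_left] at h1
      linarith)
  have := hanti (Set.left_mem_Icc.2 zero_le_one) (Set.right_mem_Icc.2 zero_le_one) zero_le_one
  simp [hv] at this
  rw [← hv] at this
  linarith

/-- For a convex function with `L`-Lipschitz gradient, the linearization error controls the squared
gradient difference. -/
lemma ConvexOn.norm_gradient_sub_sq_le {h : E → ℝ} {h' : E → E} {L : ℝ} (hL : 0 < L)
    (hc : ConvexOn ℝ Set.univ h) (hh : ∀ x, HasGradientAt h (h' x) x)
    (hlip : ∀ x y, ‖h' x - h' y‖ ≤ L * ‖x - y‖) (x y : E) :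
    ‖h' x - h' y‖ ^ 2 ≤ 2 * L * (h y - h x - ⟪h' x, y - x⟫) := by
  set D := h' x - h' y with hD
  have h1 := hc.add_inner_gradient_le (hh x) (y + L⁻¹ • D)
  have h2 := le_add_inner_gradient_add_sq hh hlip y (y + L⁻¹ • D)
  rw [add_sub_cancel_left, norm_smul, mul_pow, Real.norm_of_nonneg (by positivity),
    inner_smul_right] at h2
  rw [add_sub_right_comm, inner_add_right, inner_smul_right] at h1
  have h3 : ⟪h' x, D⟫ - ⟪h' y, D⟫ = ‖D‖ ^ 2 := by
    rw [← inner_sub_left, ← hD, real_inner_self_eq_norm_sq]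
  have h4 : L / 2 * (L⁻¹ ^ 2 * ‖D‖ ^ 2) = L⁻¹ / 2 * ‖D‖ ^ 2 := by
    field_simp
  have h5 : L⁻¹ / 2 * ‖D‖ ^ 2 ≤ h y - h x - ⟪h' x, y - x⟫ := by
    linear_combination h1 + h2 + h4 - L⁻¹ * h3
  calc ‖D‖ ^ 2 = 2 * L * (L⁻¹ / 2 * ‖D‖ ^ 2) := by field_simp
    _ ≤ _ := by gcongr

end GradientInequalities

/-- The variance of a finite family is at most its second moment. -/
lemma sum_norm_mean_sub_sq_le {E ι : Type*} [NormedAddCommGroup E] [InnerProductSpace ℝ E]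
    [Fintype ι] (D : ι → E) (m : E) (hm : ∑ i, D i = (Fintype.card ι : ℝ) • m) :
    ∑ i, ‖m - D i‖ ^ 2 ≤ ∑ i, ‖D i‖ ^ 2 := by
  have h : ∑ i, ‖m - D i‖ ^ 2 = ∑ i, ‖D i‖ ^ 2 - (Fintype.card ι : ℝ) * ‖m‖ ^ 2 := by
    simp_rw [norm_sub_sq_real, Finset.sum_add_distrib, Finset.sum_sub_distrib, ← Finset.mul_sum,
      ← inner_sum, hm, inner_smul_right, real_inner_self_eq_norm_sq]
    simp
    ring
  rw [h]
  have : 0 ≤ (Fintype.card ι : ℝ) * ‖m‖ ^ 2 := by positivity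
  linarith

/-- Progress of one ANITA step along an arbitrary gradient estimate `g`, up to the error
`G - g` of that estimate. -/
lemma anita_step_le {E : Type*} [NormedAddCommGroup E] [InnerProductSpace ℝ E]
    {L μ θ α η Fb Fu Fw Fz : ℝ} {x w u z g xp G : E} (hL : 0 < L) (hμ : 0 ≤ μ) (hθ : 0 < θ)
    (hθ' : θ < 1) (hα : 0 < α) (hη : 0 < η)
    (hηle : η ≤ α / (L * (1 + μ * η) * θ * (1 + 1 / (1 - θ))))
    (hu : u = θ • x + (1 - θ) • w)
    (hxp : xp = (1 / (1 + μ * η)) • (x + (μ * η) • u) - (η / α) • g)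
    (hsmooth : Fb ≤ Fu + ⟪G, θ • (xp - x)⟫ + L / 2 * ‖θ • (xp - x)‖ ^ 2)
    (hsc : Fu + ⟪G, z - u⟫ + μ / 2 * ‖z - u‖ ^ 2 ≤ Fz) :
    Fb ≤ (1 - θ) * Fw + θ * Fz
      + α * θ / ((1 + μ * η) * η) *
        (1 / 2 * ‖x - z‖ ^ 2 - (1 + μ * η) / 2 * ‖xp - z‖ ^ 2)
      - μ * (1 + μ * η - α) * θ / (2 * (1 + μ * η)) * ‖u - z‖ ^ 2
      + ((1 - θ) / (2 * L) * ‖G - g‖ ^ 2 + θ * ⟪G - g, x - z⟫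
        - (1 - θ) * (Fw - Fu - ⟪G, w - u⟫)) := by
  have hs : 0 < 1 + μ * η := by positivity
  have hθ1 : 0 < 1 - θ := by linarith
  have hg : g = (α / ((1 + μ * η) * η)) • ((x - xp) + (μ * η) • (u - xp)) := by
    have : (η / α) • g = (1 / (1 + μ * η)) • (x + (μ * η) • u) - xp := by rw [hxp]; abel
    have h2 : g = (α / η) • ((η / α) • g) := by
      rw [smul_smul]; field_simp; simp
    rw [h2, this]
    match_scalars <;> field_simp
    ring
  have hprox : ⟪g, xp - z⟫ = α / ((1 + μ * η) * η) *
      ((‖x - z‖ ^ 2 - ‖x - xp‖ ^ 2 - ‖xp - z‖ ^ 2) / 2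
        + μ * η * ((‖u - z‖ ^ 2 - ‖u - xp‖ ^ 2 - ‖xp - z‖ ^ 2) / 2)) := by
    conv_lhs => rw [hg]
    rw [real_inner_smul_left, inner_add_left, real_inner_smul_left, inner_sub_sub_eq_three_point,
      inner_sub_sub_eq_three_point]
  have hyoung := inner_le_weighted_norm_sq (c := L / (1 - θ)) (by positivity) (G - g)
    (θ • (xp - x))
  have hstep : L * θ * (1 + 1 / (1 - θ)) ≤ α / ((1 + μ * η) * η) := by
    rw [le_div_iff₀ (by positivity)] at hηle ⊢
    linarith
  have hstep' := mul_le_mul_of_nonneg_left hstep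
    (show 0 ≤ θ / 2 * ‖x - xp‖ ^ 2 by positivity)
  have hdrop : 0 ≤ α / ((1 + μ * η) * η) * (θ * (μ * η) / 2 * ‖u - xp‖ ^ 2) := by positivity
  have hsc' := mul_le_mul_of_nonneg_left hsc hθ.le
  rw [norm_sub_rev z u] at hsc'
  rw [norm_smul, mul_pow, Real.norm_of_nonneg hθ.le, norm_sub_rev xp x] at hsmooth hyoung
  have hlin : θ * ⟪G, z - u⟫ + (1 - θ) * ⟪G, w - u⟫ = θ * ⟪G, z - x⟫ := by
    rw [← real_inner_smul_right, ← real_inner_smul_right, ← real_inner_smul_right,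
      ← inner_add_right, hu]
    congr 1
    module
  have hsplit : ⟪G, θ • (xp - x)⟫ = ⟪G - g, θ • (xp - x)⟫ + θ * ⟪g, xp - z⟫
      + θ * ⟪G, z - x⟫ + θ * ⟪G - g, x - z⟫ := by
    simp only [real_inner_smul_right, inner_sub_left, inner_sub_right]
    ring
  have hy1 : ‖G - g‖ ^ 2 / (2 * (L / (1 - θ))) = (1 - θ) / (2 * L) * ‖G - g‖ ^ 2 := by
    field_simp
  have hc : μ * (1 + μ * η - α) * θ / (2 * (1 + μ * η)) * ‖u - z‖ ^ 2 =
      θ * (μ / 2 * ‖u - z‖ ^ 2)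
        - α / ((1 + μ * η) * η) * (θ * (μ * η) / 2 * ‖u - z‖ ^ 2) := by
    field_simp
  have hc2 : α * θ / ((1 + μ * η) * η) = α / ((1 + μ * η) * η) * θ := by ring
  have hc3 : L / (1 - θ) = L * (1 / (1 - θ)) := by ring
  rw [hsplit, hprox] at hsmooth
  rw [hy1, hc3] at hyoung
  rw [hc, hc2]
  linear_combination hsmooth + hyoung + hsc' + hstep' + hdrop - hlin

/-- Lemma 4 of the paper (one iteration of ANITA, general `μ ≥ 0` case):
expected progress of the snapshot function value after one ANITA step. -/
theorem anita_one_step_inequality {d n : ℕ} (hn : 1 ≤ n)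
    (f : Fin n → EuclideanSpace ℝ (Fin d) → ℝ) (L : ℝ) (hL : 0 < L)
    (hdiff : ∀ i, Differentiable ℝ (f i))
    (hconv : ∀ i, ConvexOn ℝ Set.univ (f i))
    (hlip : ∀ i x y, ‖gradient (f i) x - gradient (f i) y‖ ≤ L * ‖x - y‖)
    (F : EuclideanSpace ℝ (Fin d) → ℝ)
    (hF : F = fun x => (1 / (n : ℝ)) * ∑ i, f i x)
    (μ : ℝ) (hμ : 0 ≤ μ)
    (hsc : ∀ x y, F x - F y - ⟪gradient F y, x - y⟫ ≥ (μ / 2) * ‖x - y‖ ^ 2)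
    (xstar : EuclideanSpace ℝ (Fin d)) (hmin : ∀ y, F xstar ≤ F y)
    (x w : EuclideanSpace ℝ (Fin d)) (θ p α η : ℝ)
    (hθ : θ ∈ Set.Ioo (0 : ℝ) 1) (hp : p ∈ Set.Ioc (0 : ℝ) 1) (hα : 0 < α) (hη : 0 < η)
    (hηle : η ≤ α / (L * (1 + μ * η) * θ * (1 + 1 / (1 - θ))))
    (u : EuclideanSpace ℝ (Fin d)) (hu : u = θ • x + (1 - θ) • w)
    (g xp b : Fin n → EuclideanSpace ℝ (Fin d))
    (hg : ∀ i, g i = gradient (f i) u - gradient (f i) w + gradient F w)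
    (hxp : ∀ i, xp i = (1 / (1 + μ * η)) • (x + (μ * η) • u) - (η / α) • g i)
    (hb : ∀ i, b i = θ • xp i + (1 - θ) • w) :
    (1 / (n : ℝ)) * ∑ i, (p * F (b i) + (1 - p) * F w) - F xstar ≤
      (1 - p * θ) * (F w - F xstar)
        + (p * α * θ / ((1 + μ * η) * η)) *
            ((1 / 2) * ‖x - xstar‖ ^ 2
              - ((1 + μ * η) / 2) * ((1 / (n : ℝ)) * ∑ i, ‖xp i - xstar‖ ^ 2))
        - (μ * (1 + μ * η - α) * p * θ / (2 * (1 + μ * η))) * ‖u - xstar‖ ^ 2 := by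
  obtain ⟨hθ0, hθ1⟩ := hθ
  have hn0 : (n : ℝ) ≠ 0 := by positivity
  have hgrad i y : HasGradientAt (f i) (gradient (f i) y) y := (hdiff i y).hasGradientAt
  have hFgrad y : HasGradientAt F ((1 / (n : ℝ)) • ∑ i, gradient (f i) y) y := by
    have h := (HasFDerivAt.fun_sum fun i (_ : i ∈ Finset.univ) =>
      (hgrad i y).hasFDerivAt).const_mul (1 / (n : ℝ))
    rw [hasGradientAt_iff_hasFDerivAt, hF]
    simpa using h
  have hFg y : (n : ℝ) • gradient F y = ∑ i, gradient (f i) y := by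
    rw [(hFgrad y).gradient, smul_smul, mul_one_div_cancel hn0, one_smul]
  have hFv y : (n : ℝ) * F y = ∑ i, f i y := by
    rw [hF, ← mul_assoc, mul_one_div_cancel hn0, one_mul]
  have hFi y v : (n : ℝ) * ⟪gradient F y, v⟫ = ∑ i, ⟪gradient (f i) y, v⟫ := by
    rw [← real_inner_smul_left, hFg, sum_inner]
  have hsmooth y z : F z ≤ F y + ⟪gradient F y, z - y⟫ + L / 2 * ‖z - y‖ ^ 2 := by
    have h := Finset.sum_le_sum fun i (_ : i ∈ Finset.univ) =>
      le_add_inner_gradient_add_sq (hgrad i) (hlip i) y z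
    rw [Finset.sum_add_distrib, Finset.sum_add_distrib, ← hFv, ← hFv, ← hFi] at h
    simp only [Finset.sum_const, Finset.card_univ, Fintype.card_fin, nsmul_eq_mul] at h
    rw [← mul_add, ← mul_add] at h
    exact le_of_mul_le_mul_left h (by positivity)
  have hsum : ∑ i, (gradient F u - g i) = 0 := by
    simp only [hg, Finset.sum_sub_distrib, Finset.sum_add_distrib, ← hFg, Finset.sum_const,
      Finset.card_univ, Fintype.card_fin, ← Nat.cast_smul_eq_nsmul ℝ]
    abel
  have hvar : ∑ i, ‖gradient F u - g i‖ ^ 2 ≤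
      2 * L * (n * (F w - F u - ⟪gradient F u, w - u⟫)) := by
    have h1 := sum_norm_mean_sub_sq_le (fun i => gradient (f i) u - gradient (f i) w)
      (gradient F u - gradient F w)
      (by rw [Finset.sum_sub_distrib, ← hFg, ← hFg, Fintype.card_fin, smul_sub])
    have h2 := Finset.sum_le_sum fun i (_ : i ∈ Finset.univ) =>
      (hconv i).norm_gradient_sub_sq_le hL (hgrad i) (hlip i) u w
    rw [← Finset.mul_sum, Finset.sum_sub_distrib, Finset.sum_sub_distrib, ← hFv, ← hFv,
      ← hFi] at h2
    calc ∑ i, ‖gradient F u - g i‖ ^ 2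
        = ∑ i, ‖gradient F u - gradient F w - (gradient (f i) u - gradient (f i) w)‖ ^ 2 := by
          refine Finset.sum_congr rfl fun i _ => ?_
          rw [hg]
          congr 2
          abel
      _ ≤ _ := h1.trans h2
      _ = _ := by ring
  have hstep i := anita_step_le (Fw := F w) hL hμ hθ0 hθ1 hα hη hηle hu (hxp i)
    (show F (b i) ≤ F u + ⟪gradient F u, θ • (xp i - x)⟫ + L / 2 * ‖θ • (xp i - x)‖ ^ 2 by
      have hbu : θ • (xp i - x) = b i - u := by rw [hb, hu]; module
      rw [hbu]
      exact hsmooth u (b i))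
    (show F u + ⟪gradient F u, xstar - u⟫ + μ / 2 * ‖xstar - u‖ ^ 2 ≤ F xstar by
      linarith [hsc xstar u])
  have herr : ∑ i, ((1 - θ) / (2 * L) * ‖gradient F u - g i‖ ^ 2
      + θ * ⟪gradient F u - g i, x - xstar⟫
      - (1 - θ) * (F w - F u - ⟪gradient F u, w - u⟫)) ≤ 0 := by
    rw [Finset.sum_sub_distrib, Finset.sum_add_distrib, ← Finset.mul_sum, ← Finset.mul_sum,
      ← sum_inner, hsum, inner_zero_left]
    simp only [Finset.sum_const, Finset.card_univ, Fintype.card_fin, nsmul_eq_mul]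
    have h := mul_le_mul_of_nonneg_left hvar
      (show 0 ≤ (1 - θ) / (2 * L) from div_nonneg (by linarith) (by positivity))
    have h' : (1 - θ) / (2 * L) * (2 * L * (n * (F w - F u - ⟪gradient F u, w - u⟫))) =
      n * ((1 - θ) * (F w - F u - ⟪gradient F u, w - u⟫)) := by field_simp
    linarith
  have htot := Finset.sum_le_sum fun i (_ : i ∈ Finset.univ) => hstep i
  rw [Finset.sum_add_distrib] at htot
  replace htot := htot.trans (add_le_add_right herr _)
  simp only [Finset.sum_sub_distrib, Finset.sum_add_distrib, ← Finset.mul_sum, Finset.sum_const,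
    Finset.card_univ, Fintype.card_fin, nsmul_eq_mul] at htot ⊢
  have hfin := mul_le_mul_of_nonneg_left htot
    (show 0 ≤ p / n from div_nonneg hp.1.le (by positivity))
  have hnn : (1 / (n : ℝ)) * n = 1 := one_div_mul_cancel hn0
  linear_combination hfin + hnn * ((1 - p) * F w + p * ((1 - θ) * F w + θ * F xstar
    + α * θ / ((1 + μ * η) * η) * (1 / 2 * ‖x - xstar‖ ^ 2)
    - μ * (1 + μ * η - α) * θ / (2 * (1 + μ * η)) * ‖u - xstar‖ ^ 2))
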